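/- In any run of insertions into an elementary tree, suppose insert(v, x) is called during the insertion of an element x, and suppose there is an empty (unmarked) node w in the subtree under v whose parent u is marked and admissible for x. Then x is successfully inserted at some leaf in the subtree under v. -/

import Mathlib

/-!
STATEMENT 11: suppose `insert(v, x)` is called on a node `v` (path `p`, height `d`), and
there is an empty (unmarked) node `w = u ++ [b]` in the subtree under `v` whose parent `u`
is marked and admissible for `x`.  Then the call succeeds and `x` is written at some leaf
of the subtree under `v`.  (The state is assumed to satisfy the invariant, maintained by
every run of insertions, that the label of any marked non-root node is the left or right
half of the label of its — necessarily marked — parent.)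
-/

noncomputable section
attribute [local instance] Classical.propDecidable

/-- The state of an elementary tree: nodes are identified with paths from the root
(`false` = left, `true` = right); `label` records the interval `[lo, hi)` labeling a
marked node (`none` = unmarked), and `occ` records the element written in a leaf cell. -/
structure ETState where
  label : List Bool → Option (ℝ × ℝ)
  occ : List Bool → Option ℝ

/-- The initial state of an elementary tree whose root is statically labeled `I`. -/
def ETState.init (I : ℝ × ℝ) : ETState :=
  ⟨fun p => if p = [] then some I else none, fun _ => none⟩

/-- The half of the interval `I = [lo, hi)` containing `x`. -/
def halfContaining (I : ℝ × ℝ) (x : ℝ) : ℝ × ℝ :=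
  if x < (I.1 + I.2) / 2 then (I.1, (I.1 + I.2) / 2) else ((I.1 + I.2) / 2, I.2)

def ETState.setLabel (s : ETState) (p : List Bool) (I : ℝ × ℝ) : ETState :=
  ⟨fun q => if q = p then some I else s.label q, s.occ⟩

def ETState.setOcc (s : ETState) (p : List Bool) (x : ℝ) : ETState :=
  ⟨s.label, fun q => if q = p then some x else s.occ q⟩

/-- `etInsert d p pl x s` is the recursive procedure `insert(v, x)` at the node `v` with
path `p` and height `d` above the leaves (so leaves have `d = 0`), where `pl` is the label
of `v`'s parent.  It returns the success flag together with the updated state: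
* an unmarked leaf gets labeled with the half of `pl` containing `x`, and `x` is written
  into its cell (success); a marked leaf yields failure;
* a marked internal node: failure if `x` is inadmissible, otherwise insert into the left
  child and, if that fails, into the right child;
* an unmarked internal node gets labeled with the half of `pl` containing `x`, and the
  insertion proceeds into its left child. -/
def etInsert : ℕ → List Bool → (ℝ × ℝ) → ℝ → ETState → Bool × ETState
  | 0, p, pl, x, s =>
    match s.label p with
    | none => (true, (s.setLabel p (halfContaining pl x)).setOcc p x)
    | some _ => (false, s)
  | d + 1, p, pl, x, s =>
    match s.label p with
    | none =>
        let I := halfContaining pl x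
        etInsert d (p ++ [false]) I x (s.setLabel p I)
    | some I =>
        if I.1 ≤ x ∧ x < I.2 then
          match etInsert d (p ++ [false]) I x s with
          | (true, s') => (true, s')
          | (false, s') => etInsert d (p ++ [true]) I x s'
        else (false, s)

/-- Insert `x` at the root of an elementary tree of height `h` (the root is always
marked, so the parent label passed along is irrelevant). -/
def etInsertTop (h : ℕ) (x : ℝ) (s : ETState) : Bool × ETState :=
  etInsert h [] ((s.label []).getD (0, 1)) x s

/-- Insert the elements of `xs` one by one into an elementary tree of height `h` with
root label `I`, returning the conjunction of all success flags and the final state. -/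
def etRunAll (h : ℕ) (I : ℝ × ℝ) (xs : List ℝ) : Bool × ETState :=
  xs.foldl (fun acc x =>
    let r := etInsertTop h x acc.2
    (acc.1 && r.1, r.2)) (true, ETState.init I)

/-- The path (of length `h`) of the `i`-th leaf from the left in a tree of height `h`. -/
def pathOfIdx (h i : ℕ) : List Bool :=
  (List.range h).map fun k => Nat.testBit i (h - 1 - k)


theorem et_success_occ (d : ℕ) : ∀ (p : List Bool) (pl : ℝ × ℝ) (x : ℝ) (s : ETState),
    (etInsert d p pl x s).1 = true →
    ∃ q : List Bool, p <+: q ∧ q.length = p.length + d ∧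
      (etInsert d p pl x s).2.occ q = some x := by
  induction d with
  | zero =>
    intro p pl x s h
    refine ⟨p, List.prefix_refl _, rfl, ?_⟩
    unfold etInsert at h ⊢
    split at h
    · simp [ETState.setOcc]
    · simp at h
  | succ d ih =>
    have key : ∀ (c : Bool) (p : List Bool) (pl : ℝ × ℝ) (x : ℝ) (s : ETState),
        (etInsert d (p ++ [c]) pl x s).1 = true →
        ∃ q : List Bool, p <+: q ∧ q.length = p.length + (d + 1) ∧
          (etInsert d (p ++ [c]) pl x s).2.occ q = some x := by
      intro c p pl x s h
      obtain ⟨q, h1, h2, h3⟩ := ih _ _ _ _ h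
      refine ⟨q, (List.prefix_append _ _).trans h1, ?_, h3⟩
      simp at h2
      omega
    intro p pl x s h
    rw [etInsert] at h ⊢
    cases hl : s.label p with
    | none =>
      simp only [hl] at h ⊢
      exact key _ _ _ _ _ h
    | some I =>
      simp only [hl] at h ⊢
      by_cases hx : I.1 ≤ x ∧ x < I.2
      · rw [if_pos hx] at h ⊢
        have k1 := key false p I x s
        rcases hr : etInsert d (p ++ [false]) I x s with ⟨f, s'⟩
        rw [hr] at k1
        simp only [hr] at h ⊢
        cases f with
        | true => exact k1 rfl
        | false => exact key _ _ _ _ _ h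
      · rw [if_neg hx] at h
        simp at h

theorem et_empty_success (d : ℕ) : ∀ (p : List Bool) (pl : ℝ × ℝ) (x : ℝ) (s : ETState),
    (∀ r, s.label (p ++ r) = none) → (etInsert d p pl x s).1 = true := by
  induction d with
  | zero =>
    intro p pl x s h
    have h0 := h []
    rw [List.append_nil] at h0
    simp [etInsert, h0]
  | succ d ih =>
    intro p pl x s h
    have h0 := h []
    rw [List.append_nil] at h0
    rw [etInsert]
    simp only [h0]
    apply ih
    intro r
    have := h (false :: r)
    simp [ETState.setLabel, this]

theorem et_fail_same (d : ℕ) : ∀ (p : List Bool) (pl : ℝ × ℝ) (x : ℝ) (s : ETState),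
    (∀ q r, s.label q = none → s.label (q ++ r) = none) →
    (etInsert d p pl x s).1 = false → (etInsert d p pl x s).2 = s := by
  induction d with
  | zero =>
    intro p pl x s hd h
    unfold etInsert at h ⊢
    split at h
    · simp at h
    · rfl
  | succ d ih =>
    intro p pl x s hd h
    cases hl : s.label p with
    | none =>
      rw [et_empty_success _ _ _ _ _ (fun r => hd p r hl)] at h
      simp at h
    | some I =>
      rw [etInsert] at h ⊢
      simp only [hl] at h ⊢
      by_cases hx : I.1 ≤ x ∧ x < I.2
      · rw [if_pos hx] at h ⊢
        have k1 := ih (p ++ [false]) I x s hd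
        rcases hr : etInsert d (p ++ [false]) I x s with ⟨f, s'⟩
        rw [hr] at k1
        simp only [hr] at h ⊢
        cases f with
        | true => simp at h
        | false =>
          have := k1 rfl
          simp only at this
          subst this
          exact ih _ _ _ _ hd h
      · rw [if_neg hx]

theorem et_main (x : ℝ) (s : ETState)
    (hd : ∀ q r, s.label q = none → s.label (q ++ r) = none)
    (ha : ∀ q r, (∃ J : ℝ × ℝ, s.label (q ++ r) = some J ∧ J.1 ≤ x ∧ x < J.2) →
      ∃ J : ℝ × ℝ, s.label q = some J ∧ J.1 ≤ x ∧ x < J.2) (b : Bool) (d : ℕ) :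
    ∀ (p : List Bool) (pl : ℝ × ℝ) (r : List Bool), r.length + 1 ≤ d →
    s.label (p ++ r ++ [b]) = none →
    (∃ J : ℝ × ℝ, s.label (p ++ r) = some J ∧ J.1 ≤ x ∧ x < J.2) →
    (etInsert d p pl x s).1 = true := by
  induction d with
  | zero => intro p pl r h; omega
  | succ d ih =>
    intro p pl r hlen hw hu
    obtain ⟨I, hl, hx⟩ := ha p r hu
    have hc : ∃ c : Bool, (etInsert d (p ++ [c]) I x s).1 = true := by
      cases r with
      | nil =>
        refine ⟨b, et_empty_success _ _ _ _ _ fun r => hd _ _ ?_⟩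
        simpa using hw
      | cons c r =>
        refine ⟨c, ih _ _ r ?_ ?_ ?_⟩
        · simp at hlen; omega
        · simpa using hw
        · simpa using hu
    rw [etInsert]
    simp only [hl]
    rw [if_pos hx]
    have k1 := et_fail_same d (p ++ [false]) I x s hd
    rcases hr : etInsert d (p ++ [false]) I x s with ⟨f, s'⟩
    rw [hr] at k1
    cases f with
    | true => rfl
    | false =>
      have := k1 rfl
      simp only at this
      subst this
      obtain ⟨c, hc⟩ := hc
      cases c with
      | true => exact hc
      | false => rw [hr] at hc; simp at hc

theorem statement11 (d : ℕ) (p : List Bool) (pl : ℝ × ℝ) (x : ℝ) (s : ETState)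
    (hnest : ∀ (q : List Bool) (b : Bool) (J : ℝ × ℝ), s.label (q ++ [b]) = some J →
      ∃ I : ℝ × ℝ, s.label q = some I ∧
        (J = (I.1, (I.1 + I.2) / 2) ∨ J = ((I.1 + I.2) / 2, I.2)))
    (u : List Bool) (b : Bool)
    (hpu : p <+: u) (hdepth : (u ++ [b]).length ≤ p.length + d)
    (hw : s.label (u ++ [b]) = none)
    (hu : ∃ J : ℝ × ℝ, s.label u = some J ∧ J.1 ≤ x ∧ x < J.2) :
    (etInsert d p pl x s).1 = true ∧
    ∃ q : List Bool, p <+: q ∧ q.length = p.length + d ∧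
      (etInsert d p pl x s).2.occ q = some x := by
  have hd : ∀ q r, s.label q = none → s.label (q ++ r) = none := by
    intro q r hq
    induction r using List.reverseRecOn with
    | nil => simpa using hq
    | append_singleton r c ih =>
      rw [← List.append_assoc]
      by_contra hne
      obtain ⟨J, hJ⟩ := Option.ne_none_iff_exists'.mp hne
      obtain ⟨I, hI, _⟩ := hnest _ _ _ hJ
      rw [ih] at hI
      simp at hI
  have ha : ∀ q r, (∃ J : ℝ × ℝ, s.label (q ++ r) = some J ∧ J.1 ≤ x ∧ x < J.2) →
      ∃ J : ℝ × ℝ, s.label q = some J ∧ J.1 ≤ x ∧ x < J.2 := by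
    intro q r hq
    induction r using List.reverseRecOn with
    | nil => simpa using hq
    | append_singleton r c ih =>
      rw [← List.append_assoc] at hq
      obtain ⟨J, hJ, h1, h2⟩ := hq
      obtain ⟨I, hI, h⟩ := hnest _ _ _ hJ
      refine ih ⟨I, hI, ?_⟩
      rcases h with h | h <;> subst h <;> simp only at h1 h2 <;> constructor <;> linarith
  obtain ⟨r, rfl⟩ := hpu
  have hs := et_main x s hd ha b d p pl r (by simp at hdepth; omega) hw hu
  exact ⟨hs, et_success_occ d p pl x s hs⟩
end
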